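/- arXiv:0812.4064 — 2 statements merged into one kernel-verified Lean document; each statement's English description precedes it below -/
import Mathlib

section
/- The filtration F is immersed in G under P (i.e., every (F,P)-martingale is a (G,P)-martingale) if and only if for every t ≥ 0, every bounded F_∞-measurable random variable X and every bounded G_t-measurable random variable Y, one has E[X·Y | F_t] = E[X | F_t] · E[Y | F_t] P-almost surely. -/
open MeasureTheory Set
open scoped NNReal ENNReal

noncomputable section

namespace DefaultTimes

variable {Ω : Type*}

/-- The progressively enlarged filtration
`G_t = ⋂_{u>t} (F_u ∨ σ(τ ∧ s : s ≤ u))`. -/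
def enlargedFiltration {m0 : MeasurableSpace Ω}
    (F : Filtration ℝ≥0 m0) (τ : Ω → ℝ≥0∞) (hτ : Measurable τ) :
    Filtration ℝ≥0 m0 where
  seq t := ⨅ u ∈ Set.Ioi t, (F u ⊔ ⨆ s ∈ Set.Iic u,
      MeasurableSpace.comap (fun ω => min (τ ω) (s : ℝ≥0∞)) inferInstance)
  mono' := fun i j hij => le_iInf₂ fun u hu => iInf₂_le u (lt_of_le_of_lt hij hu)
  le' := fun t => by
    refine le_trans (iInf₂_le (t + 1) (lt_add_of_pos_right t one_pos)) ?_
    exact sup_le (Filtration.le _ _)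
      (iSup₂_le fun s _ => Measurable.comap_le (hτ.min measurable_const))

/-- `F` is immersed in `G` under `μ` ((H)-hypothesis): every `(F,μ)`-martingale is
a `(G,μ)`-martingale. -/
def Immersion {m0 : MeasurableSpace Ω} (F G : Filtration ℝ≥0 m0) (μ : Measure Ω) : Prop :=
  ∀ f : ℝ≥0 → Ω → ℝ, Martingale f F μ → Martingale f G μ

/-- If `X n → X` in `L¹` and the conditional expectations of `X n` given `m₁` and `m₂` eventually
agree, then so do those of `X`. -/
lemma condExp_ae_eq_of_tendsto_eLpNorm {m0 : MeasurableSpace Ω} {μ : Measure Ω}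
    (m₁ m₂ : MeasurableSpace Ω) {X : Ω → ℝ} {Xn : ℕ → Ω → ℝ} (hX : Integrable X μ)
    (hXn : ∀ n, Integrable (Xn n) μ)
    (hlim : Filter.Tendsto (fun n => eLpNorm (Xn n - X) 1 μ) Filter.atTop (nhds 0))
    (heq : ∀ᶠ n in Filter.atTop, μ[Xn n|m₂] =ᵐ[μ] μ[Xn n|m₁]) :
    μ[X|m₂] =ᵐ[μ] μ[X|m₁] := by
  have hmeas (m : MeasurableSpace Ω) (f : Ω → ℝ) : AEStronglyMeasurable[m0] (μ[f|m]) μ :=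
    integrable_condExp.aestronglyMeasurable
  have hbound : ∀ᶠ n in Filter.atTop,
      eLpNorm (μ[X|m₂] - μ[X|m₁]) 1 μ ≤ eLpNorm (Xn n - X) 1 μ + eLpNorm (Xn n - X) 1 μ := by
    filter_upwards [heq] with n hn
    have hsub : μ[X|m₂] - μ[X|m₁] =ᵐ[μ] μ[Xn n - X|m₁] - μ[Xn n - X|m₂] := by
      filter_upwards [hn, condExp_sub (hXn n) hX m₁, condExp_sub (hXn n) hX m₂] with ω h h₁ h₂
      simp only [Pi.sub_apply] at *
      rw [h₁, h₂, h]
      ring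
    rw [eLpNorm_congr_ae hsub]
    exact (eLpNorm_sub_le (hmeas _ _) (hmeas _ _) le_rfl).trans
      (add_le_add (eLpNorm_condExp_le_eLpNorm _ le_rfl) (eLpNorm_condExp_le_eLpNorm _ le_rfl))
  have hzero : eLpNorm (μ[X|m₂] - μ[X|m₁]) 1 μ = 0 :=
    le_antisymm (ge_of_tendsto (by simpa using hlim.add hlim) hbound) zero_le
  rw [eLpNorm_eq_zero_iff ((hmeas _ _).sub (hmeas _ _)) one_ne_zero] at hzero
  filter_upwards [hzero] with ω hω
  exact sub_eq_zero.mp hω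

lemma integrable_of_abs_le {m0 : MeasurableSpace Ω} {μ : Measure Ω} [IsFiniteMeasure μ]
    {X : Ω → ℝ} (hX : Measurable X) {C : ℝ} (hC : ∀ ω, |X ω| ≤ C) : Integrable X μ :=
  Integrable.of_bound hX.aestronglyMeasurable C (ae_of_all _ hC)

/-- Truncations of an integrable function converge to it in `L¹`. -/
lemma tendsto_eLpNorm_truncation {m0 : MeasurableSpace Ω} {μ : Measure Ω} {X : Ω → ℝ}
    (hX : Integrable X μ) :
    Filter.Tendsto (fun n : ℕ => eLpNorm (ProbabilityTheory.truncation X n - X) 1 μ)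
      Filter.atTop (nhds 0) := by
  have h := tendsto_lintegral_norm_of_dominated_convergence (μ := μ)
    (F := fun n : ℕ => ProbabilityTheory.truncation X n) (f := X) (bound := fun ω => |X ω|)
    (fun n => hX.1.truncation) hX.abs.hasFiniteIntegral
    (fun n => ae_of_all _ fun ω => ProbabilityTheory.abs_truncation_le_abs_self _ _ _)
    (ae_of_all _ fun ω => by
      refine tendsto_const_nhds.congr' ?_
      obtain ⟨N, hN⟩ := exists_nat_gt |X ω|
      filter_upwards [Filter.eventually_ge_atTop N] with n hn
      exact (ProbabilityTheory.truncation_eq_self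
        (hN.trans_le (Nat.cast_le.mpr hn))).symm)
  simpa only [eLpNorm_one_eq_lintegral_enorm, ofReal_norm, Pi.sub_apply] using h

/-- Under immersion, conditioning an `F_∞`-measurable variable on `G_t` or on `F_t` is the same. -/
lemma Immersion.condExp_eq {m0 : MeasurableSpace Ω} {μ : Measure Ω} [IsFiniteMeasure μ]
    {F G : Filtration ℝ≥0 m0} (h : Immersion F G μ) (t : ℝ≥0) {X : Ω → ℝ}
    (hX : Integrable X μ) (hXm : StronglyMeasurable[⨆ s, F s] X) :
    μ[X|G t] =ᵐ[μ] μ[X|F t] := by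
  let F' : Filtration ℕ m0 :=
    { seq := fun n => F n
      mono' := fun i j hij => F.mono (Nat.cast_le.mpr hij)
      le' := fun n => F.le n }
  have hsup : ⨆ s, F s ≤ ⨆ n, F' n := iSup_le fun s => by
    obtain ⟨n, hn⟩ := exists_nat_ge s
    exact (F.mono hn).trans (le_iSup (fun n => F' n) n)
  refine condExp_ae_eq_of_tendsto_eLpNorm (F t) (G t) hX (fun n => integrable_condExp)
    (hX.tendsto_eLpNorm_condExp (hXm.mono hsup)) ?_
  obtain ⟨N, hN⟩ := exists_nat_ge t
  filter_upwards [Filter.eventually_ge_atTop N] with n hn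
  have htn : t ≤ (n : ℝ≥0) := hN.trans (Nat.cast_le.mpr hn)
  have hmart := martingale_condExp X F μ
  exact ((h _ hmart).2 t n htn).trans (hmart.2 t n htn).symm

/-- If `E[X | m₂] = E[X | m₁]` with `m₁ ≤ m₂`, then the conditional expectation given `m₁` of the
product of `X` with a bounded `m₂`-measurable variable factorizes. -/
lemma condExp_mul_of_condExp_eq {m₁ m₂ m0 : MeasurableSpace Ω} {μ : Measure Ω} [IsFiniteMeasure μ]
    (h₁₂ : m₁ ≤ m₂) (h₂ : m₂ ≤ m0) {X Y : Ω → ℝ}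
    (hX : Integrable X μ) (heq : μ[X|m₂] =ᵐ[μ] μ[X|m₁])
    (hY : Measurable[m₂] Y) {C : ℝ} (hC : ∀ ω, |Y ω| ≤ C) :
    μ[X * Y|m₁] =ᵐ[μ] μ[X|m₁] * μ[Y|m₁] := by
  have hY0 : AEStronglyMeasurable Y μ := (hY.mono h₂ le_rfl).aestronglyMeasurable
  have hint {Z : Ω → ℝ} (hZ : Integrable Z μ) : Integrable (Z * Y) μ :=
    hZ.mul_bdd hY0 (ae_of_all _ hC)
  calc
    μ[X * Y|m₁] =ᵐ[μ] μ[μ[X * Y|m₂]|m₁] := (condExp_condExp_of_le h₁₂ h₂).symm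
    _ =ᵐ[μ] μ[μ[X|m₁] * Y|m₁] := condExp_congr_ae
      ((condExp_mul_of_stronglyMeasurable_right hY.stronglyMeasurable (hint hX) hX).trans
        (heq.mul .rfl))
    _ =ᵐ[μ] μ[X|m₁] * μ[Y|m₁] :=
      condExp_mul_of_stronglyMeasurable_left stronglyMeasurable_condExp
        (hint integrable_condExp) (integrable_of_abs_le (hY.mono h₂ le_rfl) hC)

/-- The product formula for conditional expectations given `m₁`, for `X` and all indicators of
`m₂`-measurable sets, forces `E[X | m₂] = E[X | m₁]`. -/
lemma condExp_eq_of_condExp_mul {m₁ m₂ m0 : MeasurableSpace Ω} {μ : Measure Ω} [IsFiniteMeasure μ]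
    (h₁₂ : m₁ ≤ m₂) (h₂ : m₂ ≤ m0) {X : Ω → ℝ}
    (hX : Integrable X μ)
    (hmul : ∀ A, MeasurableSet[m₂] A →
      μ[X * A.indicator 1|m₁] =ᵐ[μ] μ[X|m₁] * μ[A.indicator (1 : Ω → ℝ)|m₁]) :
    μ[X|m₂] =ᵐ[μ] μ[X|m₁] := by
  refine (ae_eq_condExp_of_forall_setIntegral_eq h₂ hX
    (fun A _ _ => integrable_condExp.integrableOn) (fun A hA _ => ?_)
    (stronglyMeasurable_condExp.mono h₁₂).aestronglyMeasurable).symm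
  have hset (Z : Ω → ℝ) : ∫ ω in A, Z ω ∂μ = ∫ ω, (Z * A.indicator (1 : Ω → ℝ)) ω ∂μ := by
    rw [← integral_indicator (h₂ _ hA)]
    congr 1 with ω
    by_cases hω : ω ∈ A <;> simp [hω]
  have hind : Integrable (A.indicator (1 : Ω → ℝ)) μ :=
    (integrable_const (1 : ℝ)).indicator (h₂ _ hA)
  have hint : Integrable (μ[X|m₁] * A.indicator 1) μ := by
    refine (integrable_condExp (m := m₁) (f := X)).mul_bdd (c := 1) hind.1 (ae_of_all _ fun ω => ?_)
    by_cases hω : ω ∈ A <;> simp [hω]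
  rw [hset, hset, ← integral_condExp (h₁₂.trans h₂) (f := X * A.indicator 1),
    ← integral_condExp (h₁₂.trans h₂) (f := μ[X|m₁] * A.indicator 1)]
  exact integral_congr_ae
    ((condExp_mul_of_stronglyMeasurable_left stronglyMeasurable_condExp hint hind).trans
      (hmul A hA).symm)

lemma le_enlargedFiltration {m0 : MeasurableSpace Ω} (F : Filtration ℝ≥0 m0) (τ : Ω → ℝ≥0∞)
    (hτ : Measurable τ) (t : ℝ≥0) : F t ≤ enlargedFiltration F τ hτ t :=
  le_iInf₂ fun _ hu => (F.mono (le_of_lt hu)).trans le_sup_left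

theorem stmt_0 {m0 : MeasurableSpace Ω} (P : Measure Ω) [IsProbabilityMeasure P]
    (F : Filtration ℝ≥0 m0) (τ : Ω → ℝ≥0∞) (hτ : Measurable τ) :
    Immersion F (enlargedFiltration F τ hτ) P ↔
      ∀ (t : ℝ≥0) (X Y : Ω → ℝ),
        Measurable[⨆ s, F s] X → (∃ C, ∀ ω, |X ω| ≤ C) →
        Measurable[enlargedFiltration F τ hτ t] Y → (∃ C, ∀ ω, |Y ω| ≤ C) →
        P[fun ω => X ω * Y ω|F t] =ᵐ[P] fun ω => (P[X|F t]) ω * (P[Y|F t]) ω := by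
  set G := enlargedFiltration F τ hτ
  have hFG (t : ℝ≥0) : F t ≤ G t := le_enlargedFiltration F τ hτ t
  have hF : ⨆ s, F s ≤ m0 := iSup_le F.le
  constructor
  · rintro h t X Y hX ⟨C, hC⟩ hY ⟨D, hD⟩
    have hXi : Integrable X P := integrable_of_abs_le (hX.mono hF le_rfl) hC
    exact condExp_mul_of_condExp_eq (hFG t) (G.le t) hXi
      (h.condExp_eq t hXi hX.stronglyMeasurable) hY hD
  · intro h f hf
    refine ⟨fun t => (hf.1 t).mono (hFG t), fun s t hst => ?_⟩
    have hfi : Integrable (f t) P := hf.integrable t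
    refine Filter.EventuallyEq.trans ?_ (hf.2 s t hst)
    refine condExp_ae_eq_of_tendsto_eLpNorm (F s) (G s) hfi
      (fun n => hfi.1.integrable_truncation) (tendsto_eLpNorm_truncation hfi)
      (Filter.Eventually.of_forall fun n => ?_)
    refine condExp_eq_of_condExp_mul (hFG s) (G.le s) hfi.1.integrable_truncation
      fun A hA => h s _ _ ?_ ⟨_, ProbabilityTheory.abs_truncation_le_bound _ _⟩
        ((measurable_const (a := (1 : ℝ))).indicator hA) ⟨1, fun ω => ?_⟩
    · exact (measurable_id.indicator measurableSet_Ioc).comp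
        ((hf.1 t).measurable.mono (le_iSup (fun u => F u) t) le_rfl)
    · by_cases hω : ω ∈ A <;> simp [hω]

end DefaultTimes
end
end

section
/- Suppose F is immersed in G under P. Then for every t ≥ 0, E[1_{τ>t} | F_t] = E[1_{τ>t} | F_∞] P-almost surely; consequently, for all 0 ≤ s ≤ t, E[1_{τ>t} | F_t] ≤ E[1_{τ>s} | F_s] P-almost surely, i.e. the Azéma supermartingale Z_t = P(τ > t | F_t) is almost surely nonincreasing in t. -/
open MeasureTheory Set
open scoped NNReal ENNReal

noncomputable section

namespace DefaultTimes

variable {Ω : Type*}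

/-- The conditional expectation given the terminal σ-algebra of a filtration is characterised by
the integrals over events of the filtration. -/
theorem ae_eq_condExp_iSup {ι : Type*} [SemilatticeSup ι] [Nonempty ι] {m0 : MeasurableSpace Ω}
    {P : Measure Ω} [IsFiniteMeasure P] (F : Filtration ι m0) {f g : Ω → ℝ}
    (hf : Integrable f P) (hg : Integrable g P) (hgm : StronglyMeasurable[⨆ u, F u] g)
    (h : ∀ u, ∀ A, MeasurableSet[F u] A → ∫ ω in A, g ω ∂P = ∫ ω in A, f ω ∂P) :
    g =ᵐ[P] P[f|⨆ u, F u] := by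
  have hle : (⨆ u, F u) ≤ m0 := iSup_le F.le
  have huniv : ∫ ω, g ω ∂P = ∫ ω, f ω ∂P := by
    simpa using h (Classical.arbitrary ι) univ MeasurableSet.univ
  refine ae_eq_condExp_of_forall_setIntegral_eq hle hf (fun _ _ _ => hg.integrableOn)
    (fun A hA _ => ?_) hgm.aestronglyMeasurable
  induction A, hA using MeasurableSpace.induction_on_inter
    (MeasurableSpace.generateFrom_iUnion_measurableSet fun u => F u).symm
    (isPiSystem_iUnion_of_monotone _ (fun u => @MeasurableSpace.isPiSystem_measurableSet Ω (F u))
      fun _ _ huv => F.mono huv) with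
  | empty => simp
  | basic A hA =>
    obtain ⟨u, hu⟩ := mem_iUnion.1 hA
    exact h u A hu
  | compl A hA ih =>
    have hg' := integral_add_compl (hle A hA) hg
    have hf' := integral_add_compl (hle A hA) hf
    have := ih (measure_lt_top P A)
    linarith
  | iUnion A hd hA ih =>
    rw [integral_iUnion (fun i => hle _ (hA i)) hd hg.integrableOn,
      integral_iUnion (fun i => hle _ (hA i)) hd hf.integrableOn]
    exact tsum_congr fun i => ih i (measure_lt_top P _)

theorem measurableSet_enlargedFiltration_lt {m0 : MeasurableSpace Ω}
    (F : Filtration ℝ≥0 m0) (τ : Ω → ℝ≥0∞) (hτ : Measurable τ) (t : ℝ≥0) :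
    MeasurableSet[enlargedFiltration F τ hτ t] {ω | (t : ℝ≥0∞) < τ ω} := by
  change MeasurableSet[⨅ u ∈ Set.Ioi t, _] _
  simp only [MeasurableSpace.measurableSet_iInf]
  intro u hu
  have hle : MeasurableSpace.comap (fun ω => min (τ ω) (u : ℝ≥0∞)) inferInstance ≤
      F u ⊔ ⨆ s ∈ Set.Iic u,
        MeasurableSpace.comap (fun ω => min (τ ω) (s : ℝ≥0∞)) inferInstance :=
    le_sup_of_le_right (le_iSup₂_of_le u (mem_Iic.2 le_rfl) le_rfl)
  refine hle _ ⟨Set.Ioi (t : ℝ≥0∞), measurableSet_Ioi, ?_⟩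
  ext ω
  have hu' : (t : ℝ≥0∞) < u := by exact_mod_cast mem_Ioi.1 hu
  simp [hu']

theorem integral_mul_condExp {m m0 : MeasurableSpace Ω} {P : Measure Ω} [IsFiniteMeasure P]
    (hm : m ≤ m0) {f g : Ω → ℝ} (hf : StronglyMeasurable[m] f) (hfg : Integrable (f * g) P)
    (hg : Integrable g P) : ∫ ω, f ω * (P[g|m]) ω ∂P = ∫ ω, f ω * g ω ∂P :=
  (integral_congr_ae (condExp_mul_of_stronglyMeasurable_left hf hfg hg)).symm.trans
    (integral_condExp hm)

/-- If `F` is immersed in `G`, then conditioning a `G t`-measurable event on `F t` is the same as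
conditioning it on the terminal σ-algebra of `F`. -/
theorem Immersion.condExp_indicator_ae_eq {m0 : MeasurableSpace Ω} {P : Measure Ω}
    [IsFiniteMeasure P] {F G : Filtration ℝ≥0 m0} (hImm : Immersion F G P) {t : ℝ≥0} {B : Set Ω}
    (hB : MeasurableSet[G t] B) :
    P[B.indicator (fun _ => (1 : ℝ))|F t] =ᵐ[P]
      P[B.indicator (fun _ => (1 : ℝ))|⨆ u, F u] := by
  have hintegrable : ∀ {C : Set Ω}, MeasurableSet C → Integrable (C.indicator fun _ => (1 : ℝ)) P :=
    fun hC => (integrable_const 1).indicator hC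
  have hmul : ∀ (C : Set Ω) (f : Ω → ℝ), f * C.indicator (fun _ => (1 : ℝ)) = C.indicator f := by
    intro C f
    ext ω
    by_cases h : ω ∈ C <;> simp [h]
  have hmul' : ∀ (C : Set Ω) (f : Ω → ℝ), C.indicator (fun _ => (1 : ℝ)) * f = C.indicator f :=
    fun C f => by rw [mul_comm, hmul]
  have hB0 := G.le t B hB
  refine ae_eq_condExp_iSup F (hintegrable hB0) integrable_condExp
    (stronglyMeasurable_condExp.mono (le_iSup (fun u => F u) t)) fun u A hA => ?_
  have hA0 := F.le u A hA
  set Y : Ω → ℝ := B.indicator fun _ => 1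
  set X : Ω → ℝ := A.indicator fun _ => 1
  have hY : Integrable Y P := hintegrable hB0
  have hX : Integrable X P := hintegrable hA0
  have hYm : StronglyMeasurable[G t] Y := stronglyMeasurable_const.indicator hB
  have hXv : P[X|F (max u t)] = X :=
    condExp_of_stronglyMeasurable (F.le _)
      (stronglyMeasurable_const.indicator (F.mono (le_max_left u t) A hA)) hX
  have hG : P[X|G t] =ᵐ[P] P[X|F t] := by
    simpa only [hXv] using
      (hImm _ (martingale_condExp X F P)).condExp_ae_eq (le_max_right u t)
  have key : ∀ f : Ω → ℝ, ∫ ω in A, f ω ∂P = ∫ ω, f ω * X ω ∂P := fun f => by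
    rw [← integral_indicator hA0, ← hmul]
    rfl
  rw [key, key]
  calc ∫ ω, (P[Y|F t]) ω * X ω ∂P
      = ∫ ω, (P[Y|F t]) ω * (P[X|F t]) ω ∂P :=
        (integral_mul_condExp (F.le t) stronglyMeasurable_condExp
          (by rw [hmul]; exact integrable_condExp.indicator hA0) hX).symm
    _ = ∫ ω, (P[X|F t]) ω * (P[Y|F t]) ω ∂P := by simp only [mul_comm]
    _ = ∫ ω, (P[X|F t]) ω * Y ω ∂P :=
        integral_mul_condExp (F.le t) stronglyMeasurable_condExp
          (by rw [hmul]; exact integrable_condExp.indicator hB0) hY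
    _ = ∫ ω, Y ω * (P[X|G t]) ω ∂P :=
        integral_congr_ae (hG.mono fun ω h => by simp only [h, mul_comm])
    _ = ∫ ω, Y ω * X ω ∂P :=
        integral_mul_condExp (G.le t) hYm (by rw [hmul']; exact hX.indicator hB0) hX

theorem stmt_3 {m0 : MeasurableSpace Ω} (P : Measure Ω) [IsProbabilityMeasure P]
    (F : Filtration ℝ≥0 m0) (τ : Ω → ℝ≥0∞) (hτ : Measurable τ)
    (hImm : Immersion F (enlargedFiltration F τ hτ) P) :
    (∀ t : ℝ≥0,
        P[Set.indicator {ω | (t : ℝ≥0∞) < τ ω} (fun _ => (1 : ℝ))|F t]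
          =ᵐ[P] P[Set.indicator {ω | (t : ℝ≥0∞) < τ ω} (fun _ => (1 : ℝ))|⨆ u, F u]) ∧
      ∀ s t : ℝ≥0, s ≤ t →
        P[Set.indicator {ω | (t : ℝ≥0∞) < τ ω} (fun _ => (1 : ℝ))|F t]
          ≤ᵐ[P] P[Set.indicator {ω | (s : ℝ≥0∞) < τ ω} (fun _ => (1 : ℝ))|F s] := by
  have hterm := fun t : ℝ≥0 =>
    hImm.condExp_indicator_ae_eq (measurableSet_enlargedFiltration_lt F τ hτ t)
  have hintegrable : ∀ t : ℝ≥0,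
      Integrable (Set.indicator {ω | (t : ℝ≥0∞) < τ ω} fun _ => (1 : ℝ)) P :=
    fun t => (integrable_const 1).indicator (measurableSet_lt measurable_const hτ)
  refine ⟨hterm, fun s t hst => ?_⟩
  have hmono : P[Set.indicator {ω | (t : ℝ≥0∞) < τ ω} (fun _ => (1 : ℝ))|⨆ u, F u]
      ≤ᵐ[P] P[Set.indicator {ω | (s : ℝ≥0∞) < τ ω} (fun _ => (1 : ℝ))|⨆ u, F u] :=
    condExp_mono (hintegrable t) (hintegrable s) <| .of_forall <|
      indicator_le_indicator_of_subset
        (fun _ hω => lt_of_le_of_lt (ENNReal.coe_le_coe.2 hst) hω) fun _ => zero_le_one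
  exact (hterm t).le.trans (hmono.trans (hterm s).symm.le)

end DefaultTimes
end
end
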